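/- For every prime p and m ≥ 1, the exponent λ_3(p^m) of the unit group of Z_{p^m}[ω] equals: 6 if p = 3 and m = 1; 2·3^{m−1} if p = 3 and m ≥ 2; p^{m−1}(p−1) if p ≡ 1 (mod 3); and p^{m−1}(p²−1) if p ≡ 2 (mod 3). -/

import Mathlib

open Polynomial

/-- The ring of Eisenstein integers modulo `n`: `(ℤ/n)[x]/(x² + x + 1)`. -/
abbrev EisensteinMod (n : ℕ) : Type :=
  Polynomial (ZMod n) ⧸ Ideal.span {(X ^ 2 + X + 1 : Polynomial (ZMod n))}

section CommRing

variable {R : Type*} [CommRing R]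

/-- The Frobenius congruence for `a + b w`, with `a` and `b` integers. -/
lemma prime_dvd_add_mul_pow_sub {p : ℕ} (hp : p.Prime) (a b : ℤ) (w : R) :
    (p : R) ∣ (a + b * w) ^ p - (a + b * w ^ p) := by
  have fermat (c : ℤ) : (p : R) ∣ (c : R) ^ p - c := by
    have := Fact.mk hp
    have h : (p : ℤ) ∣ c ^ p - c := by
      rw [← ZMod.intCast_zmod_eq_zero_iff_dvd]
      simp
    simpa using map_dvd (Int.castRingHom R) h
  obtain ⟨r, hr⟩ := exists_add_pow_prime_eq hp (a : R) (b * w)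
  obtain ⟨s, hs⟩ := fermat a
  obtain ⟨t, ht⟩ := fermat b
  refine ⟨s + t * w ^ p + a * (b * w) * r, ?_⟩
  rw [hr, mul_pow]
  linear_combination hs + w ^ p * ht

lemma pow_three_eq_one_of_root {w : R} (hw : w ^ 2 + w + 1 = 0) : w ^ 3 = 1 := by
  linear_combination (w - 1) * hw

lemma pow_eq_pow_mod_three {w : R} (hw : w ^ 2 + w + 1 = 0) (k : ℕ) : w ^ k = w ^ (k % 3) :=
  pow_eq_pow_mod k (pow_three_eq_one_of_root hw)

/-- Raising to the power `3 ^ k` gains `k` factors of `3` in a congruence to `1`. -/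
lemma three_pow_dvd_pow_sub_one {x : R} {j : ℕ} (hj : 1 ≤ j) (h : (3 : R) ^ j ∣ x - 1) (k : ℕ) :
    (3 : R) ^ (j + k) ∣ x ^ 3 ^ k - 1 := by
  induction k with
  | zero => simpa using h
  | succ k ih =>
    obtain ⟨y, hy⟩ := ih
    obtain ⟨i, rfl⟩ : ∃ i, j = i + 1 := ⟨j - 1, by omega⟩
    refine ⟨y * (1 + 3 ^ (i + 1 + k) * y + 3 ^ (i + k) * 3 ^ (i + 1 + k) * y ^ 2), ?_⟩
    rw [pow_succ 3 k, pow_mul, sub_eq_iff_eq_add.mp hy]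
    ring

/-- If `w` is a primitive cube root of unity, the cube of an element of `ℤ[w]` that is congruent
to `1` modulo `w - 1` is congruent to `1` modulo `9`. -/
lemma nine_dvd_pow_three_sub_one {w : R} (hw : w ^ 2 + w + 1 = 0) (a b : ℤ) :
    (9 : R) ∣ (1 + (w - 1) * (a + b * w)) ^ 3 - 1 := by
  have h : (3 : ℤ) ∣ (a + b) ^ 3 - (a + b) := by
    have := Fact.mk Nat.prime_three
    rw [show (3 : ℤ) = (3 : ℕ) from rfl, ← ZMod.intCast_zmod_eq_zero_iff_dvd]
    simp
  obtain ⟨c, hc⟩ := h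
  have hc : ((a : R) + b) ^ 3 - (a + b) = 3 * c := mod_cast congrArg (Int.cast : ℤ → R) hc
  have hsq : (w - 1) ^ 2 = -3 * w := by linear_combination hw
  have hthree : (3 : R) = -(w - 1) ^ 2 * w ^ 2 := by
    linear_combination w ^ 2 * hsq - 3 * (w - 1) * hw
  set t : R := a + b with ht
  set x : R := a + b * w with hx
  have hxt : x = t + (w - 1) * b := by rw [hx, ht]; ring
  set z : R := (w - 1) * w ^ 2 * c + b - 3 * t ^ 2 * b - 3 * t * (w - 1) * b ^ 2
    - (w - 1) ^ 2 * b ^ 3 + x ^ 2 - x ^ 3 with hz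
  have hfactor : x + (w - 1) * x ^ 2 - w * x ^ 3 = (w - 1) * z := by
    rw [hz, hxt]
    linear_combination -hc - c * hthree
  refine ⟨-w * z, ?_⟩
  linear_combination 3 * (w - 1) * hfactor + ((w - 1) * x ^ 3 + 3 * z) * hsq

end CommRing

namespace EisensteinMod

variable {n : ℕ}

/-- The class of `X`, a primitive cube root of unity. -/
noncomputable def omega (n : ℕ) : EisensteinMod n := Ideal.Quotient.mk _ X

lemma omega_root (n : ℕ) : omega n ^ 2 + omega n + 1 = 0 := by
  have : Ideal.Quotient.mk (Ideal.span {(X ^ 2 + X + 1 : (ZMod n)[X])}) (X ^ 2 + X + 1) = 0 :=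
    Ideal.Quotient.eq_zero_iff_mem.mpr (Ideal.mem_span_singleton_self _)
  rwa [map_add, map_add, map_pow, map_one] at this

lemma natDegree_cyclotomic_three [Nontrivial (ZMod n)] :
    (X ^ 2 + X + 1 : (ZMod n)[X]).natDegree = 2 := by
  compute_degree!

lemma monic_cyclotomic_three : (X ^ 2 + X + 1 : (ZMod n)[X]).Monic := by
  nontriviality (ZMod n)
  monicity!

lemma exists_eq_add_mul_omega (r : EisensteinMod n) : ∃ a b : ℤ, r = a + b * omega n := by
  obtain ⟨f, rfl⟩ := Ideal.Quotient.mk_surjective r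
  induction f using Polynomial.induction_on' with
  | add f g hf hg =>
    obtain ⟨a, b, h⟩ := hf
    obtain ⟨c, d, h'⟩ := hg
    refine ⟨a + c, b + d, ?_⟩
    rw [map_add, h, h']
    push_cast
    ring
  | monomial k c =>
    obtain ⟨c, rfl⟩ := ZMod.intCast_surjective c
    have h : (Ideal.Quotient.mk (Ideal.span {(X ^ 2 + X + 1 : (ZMod n)[X])}))
        (monomial k (c : ZMod n)) = (c : EisensteinMod n) * omega n ^ (k % 3) := by
      rw [← pow_eq_pow_mod_three (omega_root n), ← C_mul_X_pow_eq_monomial]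
      simp [omega]
    rw [h]
    have : k % 3 < 3 := Nat.mod_lt _ (by norm_num)
    interval_cases k % 3
    · exact ⟨c, 0, by simp⟩
    · exact ⟨0, c, by simp⟩
    · refine ⟨-c, -c, ?_⟩
      push_cast
      linear_combination (c : EisensteinMod n) * omega_root n

lemma algebraMap_injective [Nontrivial (ZMod n)] :
    Function.Injective (algebraMap (ZMod n) (EisensteinMod n)) := by
  rw [injective_iff_map_eq_zero]
  intro c hc
  by_contra h
  exact AdjoinRoot.mk_ne_zero_of_natDegree_lt (monic_cyclotomic_three (n := n)) (C_ne_zero.mpr h)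
    (by simp [natDegree_cyclotomic_three]) hc

lemma omega_ne_one [Nontrivial (ZMod n)] : omega n ≠ 1 := by
  intro h
  refine AdjoinRoot.mk_ne_zero_of_natDegree_lt (monic_cyclotomic_three (n := n))
    (X_sub_C_ne_zero 1) (by rw [natDegree_X_sub_C, natDegree_cyclotomic_three]; norm_num) ?_
  rw [map_sub, map_one, map_one]
  exact sub_eq_zero.mpr h

lemma exponent_zmod_units_dvd [Nontrivial (ZMod n)] :
    Monoid.exponent (ZMod n)ˣ ∣ Monoid.exponent (EisensteinMod n)ˣ :=
  Monoid.exponent_dvd_of_monoidHom (Units.map (algebraMap (ZMod n) (EisensteinMod n)).toMonoidHom)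
    (Units.map_injective algebraMap_injective)

lemma natCast_pow_eq_zero (p m : ℕ) : (p : EisensteinMod (p ^ m)) ^ m = 0 := by
  rw [← Nat.cast_pow, ← map_natCast (algebraMap (ZMod (p ^ m)) (EisensteinMod (p ^ m)))]
  simp

lemma pow_eq_one_of_prime_dvd {p m : ℕ} (hm : 1 ≤ m) {x : EisensteinMod (p ^ m)}
    (h : (p : EisensteinMod (p ^ m)) ∣ x - 1) : x ^ p ^ (m - 1) = 1 := by
  have := dvd_sub_pow_of_dvd_sub h (m - 1)
  rw [Nat.sub_add_cancel hm, natCast_pow_eq_zero, zero_dvd_iff, one_pow] at this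
  exact sub_eq_zero.mp this

lemma exponent_dvd_of_prime_dvd {p m k : ℕ} (hk : 1 ≤ k) (hm : 1 ≤ m)
    (h : ∀ a b : ℤ, (p : EisensteinMod (p ^ m)) ∣
      (a + b * omega (p ^ m)) ^ k - (a + b * omega (p ^ m))) :
    Monoid.exponent (EisensteinMod (p ^ m))ˣ ∣ p ^ (m - 1) * (k - 1) := by
  refine Monoid.exponent_dvd_of_forall_pow_eq_one fun u ↦ Units.ext ?_
  rw [mul_comm, pow_mul, Units.val_pow_eq_pow_val]
  refine pow_eq_one_of_prime_dvd hm ?_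
  obtain ⟨a, b, hab⟩ := exists_eq_add_mul_omega (u : EisensteinMod (p ^ m))
  have := h a b
  rw [← hab] at this
  obtain ⟨c, hc⟩ := this
  refine ⟨c * (u⁻¹ : (EisensteinMod (p ^ m))ˣ), ?_⟩
  rw [← mul_assoc, ← hc, sub_mul, Units.mul_inv, ← Nat.sub_add_cancel hk]
  simp [pow_succ, mul_assoc]

lemma exponent_dvd_of_mod_three_eq_one {p m : ℕ} (hp : p.Prime) (hm : 1 ≤ m) (h : p % 3 = 1) :
    Monoid.exponent (EisensteinMod (p ^ m))ˣ ∣ p ^ (m - 1) * (p - 1) := by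
  refine exponent_dvd_of_prime_dvd hp.one_le hm fun a b ↦ ?_
  have := prime_dvd_add_mul_pow_sub hp a b (omega (p ^ m))
  rwa [pow_eq_pow_mod_three (omega_root _) p, h, pow_one] at this

lemma exponent_dvd_of_mod_three_eq_two {p m : ℕ} (hp : p.Prime) (hm : 1 ≤ m) (h : p % 3 = 2) :
    Monoid.exponent (EisensteinMod (p ^ m))ˣ ∣ p ^ (m - 1) * (p ^ 2 - 1) := by
  refine exponent_dvd_of_prime_dvd (Nat.one_le_pow _ _ hp.pos) hm fun a b ↦ ?_
  have hmod : (p * p) % 3 = 1 := by simp [Nat.mul_mod, h]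
  have h₁ := prime_dvd_add_mul_pow_sub hp a b (omega (p ^ m))
  have h₂ := prime_dvd_add_mul_pow_sub hp a b (omega (p ^ m) ^ p)
  rw [← pow_mul, pow_eq_pow_mod_three (omega_root _) (p * p), hmod, pow_one] at h₂
  have h₃ := (h₁.trans (sub_dvd_pow_sub_pow _ _ p)).add h₂
  rwa [sub_add_sub_cancel, ← pow_mul, ← pow_two p] at h₃

lemma totient_dvd_exponent {p m : ℕ} (hp : p.Prime) (hp2 : p ≠ 2) (hm : 1 ≤ m) :
    p ^ (m - 1) * (p - 1) ∣ Monoid.exponent (EisensteinMod (p ^ m))ˣ := by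
  have : Fact (1 < p ^ m) := ⟨Nat.one_lt_pow (by omega) hp.one_lt⟩
  have : NeZero (p ^ m) := ⟨pow_ne_zero m hp.ne_zero⟩
  have := ZMod.isCyclic_units_of_prime_pow p hp hp2 m
  rw [← Nat.totient_prime_pow hp hm, ← ZMod.card_units_eq_totient, ← Nat.card_eq_fintype_card,
    ← IsCyclic.exponent_eq_card]
  exact exponent_zmod_units_dvd

lemma two_pow_dvd_exponent {m : ℕ} (hm : 1 ≤ m) :
    2 ^ (m - 1) ∣ Monoid.exponent (EisensteinMod (2 ^ m))ˣ := by
  obtain rfl | ⟨k, rfl⟩ : m = 1 ∨ ∃ k, m = k + 2 := by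
    rcases hm.eq_or_lt with h | h
    · exact .inl h.symm
    · exact .inr ⟨m - 2, by omega⟩
  · simp
  have : Fact (1 < 2 ^ (k + 2)) := ⟨Nat.one_lt_pow (by omega) one_lt_two⟩
  have hneg : 2 ∣ Monoid.exponent (EisensteinMod (2 ^ (k + 2)))ˣ := by
    have : Fact (2 < 2 ^ (k + 2)) := ⟨by have := Nat.one_le_two_pow (n := k); rw [pow_add]; omega⟩
    have h : orderOf (-1 : (ZMod (2 ^ (k + 2)))ˣ) = 2 := by
      refine orderOf_eq_prime (by simp) fun h ↦ ?_
      exact ZMod.neg_one_ne_one (congrArg Units.val h)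
    exact (h ▸ Monoid.order_dvd_exponent _).trans exponent_zmod_units_dvd
  obtain ⟨f, hf⟩ := hneg
  have horder := ZMod.orderOf_one_add_four_mul (-1) (by decide) k
  have hunit : IsUnit (1 + 2 * omega (2 ^ (k + 2))) :=
    IsUnit.of_pow_eq_one (pow_eq_one_of_prime_dvd hm ⟨omega _, by push_cast; ring⟩)
      (pow_ne_zero _ two_ne_zero)
  have hpow : (1 + 4 * ((-1 : ℤ) : ZMod (2 ^ (k + 2)))) ^ f = 1 := by
    apply algebraMap_injective
    have := congrArg Units.val (Monoid.pow_exponent_eq_one hunit.unit)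
    rw [Units.val_pow_eq_pow_val, hf, pow_mul, Units.val_one, IsUnit.unit_spec] at this
    rw [map_pow, map_one, ← this]
    congr 1
    simp only [map_add, map_mul, map_one, map_ofNat, map_neg, Int.cast_neg, Int.cast_one]
    linear_combination -4 * omega_root (2 ^ (k + 2))
  rw [hf, show k + 2 - 1 = k + 1 by omega, pow_succ']
  exact mul_dvd_mul_left 2 (horder ▸ orderOf_dvd_of_pow_eq_one hpow)

lemma nine_dvd_unit_pow_six_sub_one {m : ℕ} (hm : 1 ≤ m) (u : (EisensteinMod (3 ^ m))ˣ) :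
    (9 : EisensteinMod (3 ^ m)) ∣ (u : EisensteinMod (3 ^ m)) ^ 6 - 1 := by
  have : Fact (1 < 3 ^ m) := ⟨Nat.one_lt_pow (by omega) (by norm_num)⟩
  have : Nontrivial (EisensteinMod (3 ^ m)) := algebraMap_injective.nontrivial
  set w := omega (3 ^ m) with hw
  have hroot : w ^ 2 + w + 1 = 0 := omega_root _
  have hthree : (3 : EisensteinMod (3 ^ m)) = -(w - 1) ^ 2 * w ^ 2 := by
    linear_combination (w ^ 2 - 3 * w + 3) * hroot
  obtain ⟨a, b, hab⟩ := exists_eq_add_mul_omega (u : EisensteinMod (3 ^ m))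
  rw [← hw] at hab
  suffices h : ∃ e y : EisensteinMod (3 ^ m), e ^ 2 = 1 ∧ (u : EisensteinMod (3 ^ m)) =
      e + (w - 1) * y by
    obtain ⟨e, y, he, hu⟩ := h
    obtain ⟨c, d, hcd⟩ := exists_eq_add_mul_omega (2 * e * y + (w - 1) * y ^ 2)
    have := nine_dvd_pow_three_sub_one hroot c d
    rw [← hcd] at this
    convert this using 2
    rw [show 6 = 2 * 3 from rfl, pow_mul, hu]
    congr 1
    linear_combination he
  have hmod : (a + b) % 3 = 0 ∨ (a + b) % 3 = 1 ∨ (a + b) % 3 = 2 := by omega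
  rcases hmod with h | h | h
  · obtain ⟨d, hd⟩ := Int.dvd_of_emod_eq_zero h
    have hd : (a : EisensteinMod (3 ^ m)) = 3 * d - b := by
      rw [eq_sub_iff_add_eq]; exact mod_cast congrArg (Int.cast : ℤ → EisensteinMod (3 ^ m)) hd
    have hsq : (u : EisensteinMod (3 ^ m)) ^ 2 =
        3 * (3 * d ^ 2 + 2 * d * b * (w - 1) - w * b ^ 2) := by
      rw [hab, hd]
      linear_combination (b : EisensteinMod (3 ^ m)) ^ 2 * hroot
    have hzero : (u : EisensteinMod (3 ^ m)) ^ (2 * m) = 0 := by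
      have := natCast_pow_eq_zero 3 m
      rw [Nat.cast_ofNat] at this
      rw [pow_mul, hsq, mul_pow, this, zero_mul]
    exact absurd hzero (u.isUnit.pow _).ne_zero
  · have hd : (a : EisensteinMod (3 ^ m)) = 3 * ((a + b) / 3 : ℤ) + 1 - b := by
      rw [eq_sub_iff_add_eq]
      have h' : a + b = 3 * ((a + b) / 3) + 1 := by omega
      exact mod_cast congrArg (Int.cast : ℤ → EisensteinMod (3 ^ m)) h'
    refine ⟨1, b - (w - 1) * w ^ 2 * ((a + b) / 3 : ℤ), by ring, ?_⟩
    rw [hab, hd]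
    linear_combination (((a + b) / 3 : ℤ) : EisensteinMod (3 ^ m)) * hthree
  · have hd : (a : EisensteinMod (3 ^ m)) = 3 * ((a + b + 1) / 3 : ℤ) - 1 - b := by
      rw [eq_sub_iff_add_eq]
      have h' : a + b = 3 * ((a + b + 1) / 3) - 1 := by omega
      exact mod_cast congrArg (Int.cast : ℤ → EisensteinMod (3 ^ m)) h'
    refine ⟨-1, b - (w - 1) * w ^ 2 * ((a + b + 1) / 3 : ℤ), by ring, ?_⟩
    rw [hab, hd]
    linear_combination (((a + b + 1) / 3 : ℤ) : EisensteinMod (3 ^ m)) * hthree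

lemma exponent_three_pow_dvd {m : ℕ} (hm : 2 ≤ m) :
    Monoid.exponent (EisensteinMod (3 ^ m))ˣ ∣ 2 * 3 ^ (m - 1) := by
  obtain ⟨k, rfl⟩ : ∃ k, m = 2 + k := ⟨m - 2, by omega⟩
  refine Monoid.exponent_dvd_of_forall_pow_eq_one fun u ↦ Units.ext ?_
  have h := three_pow_dvd_pow_sub_one (j := 2) (by norm_num)
    (by convert nine_dvd_unit_pow_six_sub_one (by omega) u using 1; norm_num) k
  have hzero := natCast_pow_eq_zero 3 (2 + k)
  rw [Nat.cast_ofNat] at hzero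
  rw [hzero, zero_dvd_iff, ← pow_mul] at h
  rw [Units.val_pow_eq_pow_val, Units.val_one, ← sub_eq_zero, ← h,
    show 2 + k - 1 = k + 1 by omega]
  congr 2
  ring

lemma exponent_three_dvd : Monoid.exponent (EisensteinMod (3 ^ 1))ˣ ∣ 6 := by
  refine Monoid.exponent_dvd_of_forall_pow_eq_one fun u ↦ Units.ext ?_
  have h := nine_dvd_unit_pow_six_sub_one le_rfl u
  have hzero := natCast_pow_eq_zero 3 1
  rw [Nat.cast_ofNat, pow_one (3 : EisensteinMod (3 ^ 1))] at hzero
  rw [show (9 : EisensteinMod (3 ^ 1)) = 3 * 3 by norm_num, hzero, zero_mul, zero_dvd_iff] at h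
  exact sub_eq_zero.mp h

lemma three_dvd_exponent [Nontrivial (ZMod n)] : 3 ∣ Monoid.exponent (EisensteinMod n)ˣ := by
  have hpow := pow_three_eq_one_of_root (omega_root n)
  have hunit : IsUnit (omega n) := IsUnit.of_pow_eq_one hpow three_ne_zero
  have h : orderOf hunit.unit = 3 :=
    orderOf_eq_prime (Units.ext hpow) fun h ↦ omega_ne_one (congrArg Units.val h)
  exact h ▸ Monoid.order_dvd_exponent _

lemma not_root_of_mod_three_eq_two {p : ℕ} [Fact p.Prime] (h : p % 3 = 2) (x : ZMod p) :
    x ^ 2 + x + 1 ≠ 0 := by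
  intro hx
  have hx3 := pow_three_eq_one_of_root hx
  have hx1 : x ≠ 1 := by
    rintro rfl
    have h3 : ((3 : ℕ) : ZMod p) = 0 := by push_cast; linear_combination hx
    rw [ZMod.natCast_eq_zero_iff] at h3
    have := (Nat.prime_dvd_prime_iff_eq Fact.out Nat.prime_three).mp h3
    omega
  have hx0 : x ≠ 0 := by
    rintro rfl
    simp at hx
  have h3 : 3 ∣ p - 1 := orderOf_eq_prime hx3 hx1 ▸ ZMod.orderOf_dvd_card_sub_one hx0
  omega

lemma isUnit_of_not_dvd {p m : ℕ} (hp : p.Prime) (h : p % 3 = 2) {a b : ℤ}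
    (hab : ¬ ((p : ℤ) ∣ a ∧ (p : ℤ) ∣ b)) :
    IsUnit ((a : EisensteinMod (p ^ m)) + b * omega (p ^ m)) := by
  have := Fact.mk hp
  have hnorm : ((a ^ 2 - a * b + b ^ 2 : ℤ) : ZMod p) ≠ 0 := by
    intro hN
    push_cast at hN
    apply hab
    rw [← ZMod.intCast_zmod_eq_zero_iff_dvd, ← ZMod.intCast_zmod_eq_zero_iff_dvd]
    have hb : (b : ZMod p) = 0 := by
      by_contra hb
      apply not_root_of_mod_three_eq_two h (-a / b : ZMod p)
      field_simp
      linear_combination hN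
    exact ⟨by simpa [hb] using hN, hb⟩
  have hcop : IsCoprime (a ^ 2 - a * b + b ^ 2) ((p ^ m : ℕ) : ℤ) := by
    rw [Ne, ZMod.intCast_zmod_eq_zero_iff_dvd] at hnorm
    push_cast
    exact (((Nat.prime_iff_prime_int.mp hp).coprime_iff_not_dvd).mpr hnorm).symm.pow_right
  have hunit : IsUnit ((a ^ 2 - a * b + b ^ 2 : ℤ) : EisensteinMod (p ^ m)) := by
    obtain ⟨s, t, hst⟩ := hcop
    refine IsUnit.of_mul_eq_one (s : EisensteinMod (p ^ m)) ?_
    have hst := congrArg (Int.cast : ℤ → EisensteinMod (p ^ m)) hst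
    have hzero := natCast_pow_eq_zero p m
    push_cast at hst ⊢
    linear_combination hst - t * hzero
  refine isUnit_of_dvd_unit ⟨(a - b) - b * omega (p ^ m), ?_⟩ hunit
  push_cast
  linear_combination (b : EisensteinMod (p ^ m)) ^ 2 * omega_root (p ^ m)

lemma sq_sub_one_dvd_exponent {p m : ℕ} (hp : p.Prime) (hm : 1 ≤ m) (h : p % 3 = 2) :
    p ^ 2 - 1 ∣ Monoid.exponent (EisensteinMod (p ^ m))ˣ := by
  have := Fact.mk hp
  have hirr : Irreducible (X ^ 2 + X + 1 : (ZMod p)[X]) := by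
    refine irreducible_of_degree_le_three_of_not_isRoot
      (by rw [natDegree_cyclotomic_three]; decide) fun x hx ↦ not_root_of_mod_three_eq_two h x ?_
    simpa using hx
  have := Fact.mk hirr
  let K := AdjoinRoot (X ^ 2 + X + 1 : (ZMod p)[X])
  let pb := AdjoinRoot.powerBasis' (monic_cyclotomic_three (n := p))
  have : Module.Finite (ZMod p) K := pb.finite
  have : Finite K := Module.finite_of_finite (ZMod p)
  have hcard : Nat.card Kˣ = p ^ 2 - 1 := by
    rw [Nat.card_units, Module.natCard_eq_pow_finrank (K := ZMod p), pb.finrank,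
      AdjoinRoot.powerBasis'_dim, natDegree_cyclotomic_three, Nat.card_zmod]
  rw [← hcard, ← IsCyclic.exponent_eq_card]
  refine Monoid.exponent_dvd_of_forall_pow_eq_one fun y ↦ Units.ext ?_
  let φ : EisensteinMod (p ^ m) →+* K :=
    AdjoinRoot.map (ZMod.castHom (dvd_pow_self p (by omega)) (ZMod p)) _ _ (by simp)
  have hφ : φ (omega _) = omega p := AdjoinRoot.map_root _ _ _ _
  obtain ⟨a, b, hab⟩ := exists_eq_add_mul_omega (n := p) (y : K)
  have hunit : IsUnit ((a : EisensteinMod (p ^ m)) + b * omega (p ^ m)) := by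
    refine isUnit_of_not_dvd hp h fun ⟨ha, hb⟩ ↦ y.ne_zero ?_
    have hcast {c : ℤ} (hc : (p : ℤ) ∣ c) : (c : EisensteinMod p) = 0 := by
      rw [← map_intCast (algebraMap (ZMod p) (EisensteinMod p)),
        (ZMod.intCast_zmod_eq_zero_iff_dvd c p).mpr hc, map_zero]
    rw [hab, hcast ha, hcast hb, zero_mul, add_zero]
    rfl
  have hy : φ hunit.unit = y := by
    rw [hunit.unit_spec, map_add, map_mul, map_intCast, map_intCast, hφ, hab]
    rfl
  rw [Units.val_pow_eq_pow_val, ← hy, ← map_pow, ← Units.val_pow_eq_pow_val,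
    Monoid.pow_exponent_eq_one, Units.val_one, map_one, Units.val_one]

lemma exponent_of_mod_three_eq_two {p m : ℕ} (hp : p.Prime) (hm : 1 ≤ m) (h : p % 3 = 2) :
    Monoid.exponent (EisensteinMod (p ^ m))ˣ = p ^ (m - 1) * (p ^ 2 - 1) := by
  refine dvd_antisymm (exponent_dvd_of_mod_three_eq_two hp hm h) ?_
  refine Nat.Coprime.mul_dvd_of_dvd_of_dvd (Nat.Coprime.pow_left _ ?_) ?_
    (sq_sub_one_dvd_exponent hp hm h)
  · refine (Nat.Prime.coprime_iff_not_dvd hp).mpr fun hdvd ↦ hp.one_lt.ne' ?_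
    have hpos : 1 ≤ p ^ 2 := Nat.one_le_pow _ _ hp.pos
    exact Nat.dvd_one.mp ((Nat.dvd_sub_iff_right hpos (dvd_pow_self p two_ne_zero)).mp hdvd)
  · rcases eq_or_ne p 2 with rfl | hp2
    · exact two_pow_dvd_exponent hm
    · exact (dvd_mul_right _ _).trans (totient_dvd_exponent hp hp2 hm)

end EisensteinMod

open EisensteinMod

theorem eisenstein_exponent_formula (p m : ℕ) (hp : p.Prime) (hm : 1 ≤ m) :
    (p = 3 → m = 1 → Monoid.exponent (EisensteinMod (p ^ m))ˣ = 6) ∧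
    (p = 3 → 2 ≤ m →
      Monoid.exponent (EisensteinMod (p ^ m))ˣ = 2 * 3 ^ (m - 1)) ∧
    (p % 3 = 1 →
      Monoid.exponent (EisensteinMod (p ^ m))ˣ = p ^ (m - 1) * (p - 1)) ∧
    (p % 3 = 2 →
      Monoid.exponent (EisensteinMod (p ^ m))ˣ = p ^ (m - 1) * (p ^ 2 - 1)) := by
  refine ⟨?_, ?_, fun h ↦ ?_, exponent_of_mod_three_eq_two hp hm⟩
  · rintro rfl rfl
    have : Fact (1 < 3 ^ 1) := ⟨by norm_num⟩
    refine dvd_antisymm exponent_three_dvd ?_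
    exact Nat.Coprime.mul_dvd_of_dvd_of_dvd (m := 2) (n := 3) (by norm_num)
      (totient_dvd_exponent hp (by norm_num) hm) three_dvd_exponent
  · rintro rfl h
    refine dvd_antisymm (exponent_three_pow_dvd h) ?_
    rw [mul_comm]
    exact totient_dvd_exponent hp (by norm_num) hm
  · exact dvd_antisymm (exponent_dvd_of_mod_three_eq_one hp hm h)
      (totient_dvd_exponent hp (by rintro rfl; omega) hm)
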